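/- arXiv:2505.17940 — 3 statements merged into one kernel-verified Lean document; each statement's English description precedes it below -/
import Mathlib

section
/- Let g : ℕ → ℂ be multiplicative (g(1) = 1 and g(ab) = g(a)g(b) for coprime a, b) and let A > 0 satisfy |g(p) − 1| ≤ A/p for all primes p. For every ε > 0 there exists C > 0, depending only on A and ε, such that for every integer m ≥ 1 and every real Y ≥ 2: | ∑_{0 < d ≤ Y, d squarefree, gcd(d,m)=1} g(d) − Y · ∏_{p | m} (1 − 1/p) · ∏_{p ∤ m} (1 − 1/p)(1 + g(p)/p) | ≤ C · m^ε · Y^{1/2+ε}. -/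
lemma two_prod_bound (e : ℝ) (he : 0 < e) : ∃ K : ℝ, 0 < K ∧ ∀ m : ℕ, 1 ≤ m →
    ∏ _p ∈ m.primeFactors, (2 : ℝ) ≤ K * (m : ℝ) ^ e := by
  obtain ⟨Q, hQ⟩ := exists_nat_ge ((2 : ℝ) ^ (1 / e))
  refine ⟨2 ^ Q, by positivity, fun m hm => ?_⟩
  have h1 : ∀ p ∈ m.primeFactors, (2 : ℝ) ≤ (if p < Q then 2 else 1) * (p : ℝ) ^ e := by
    intro p hp
    have hp1 : (1 : ℝ) ≤ p := by
      exact_mod_cast (Nat.prime_of_mem_primeFactors hp).one_lt.le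
    split_ifs with h
    · have := Real.one_le_rpow hp1 he.le
      linarith
    · have : (2 : ℝ) ^ (1 / e) ≤ p := hQ.trans (by exact_mod_cast not_lt.mp h)
      have h2 := Real.rpow_le_rpow (by positivity) this he.le
      rw [← Real.rpow_mul (by norm_num), one_div_mul_cancel he.ne', Real.rpow_one] at h2
      linarith
  refine (Finset.prod_le_prod (fun _ _ => by norm_num) h1).trans ?_
  rw [Finset.prod_mul_distrib]
  gcongr
  · rw [Finset.prod_ite]
    simp only [Finset.prod_const, one_pow, mul_one]
    apply pow_le_pow_right₀ (by norm_num)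
    calc _ ≤ (Finset.range Q).card := Finset.card_le_card (fun x hx => by
            simp at hx ⊢; exact hx.2)
      _ = Q := by simp
  · rw [Real.finsetProd_rpow _ _ (fun _ _ => by positivity)]
    apply Real.rpow_le_rpow (by positivity) _ he.le
    have := Nat.le_of_dvd hm (Nat.prod_primeFactors_dvd m)
    calc (∏ i ∈ m.primeFactors, (i : ℝ)) = ((∏ i ∈ m.primeFactors, i : ℕ) : ℝ) := by push_cast; rfl
      _ ≤ m := by exact_mod_cast this

lemma floor_sub_bound (x s : ℝ) (hx : 0 ≤ x) (hs0 : 0 ≤ s) (hs1 : s ≤ 1) :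
    |(⌊x⌋₊ : ℝ) - x| ≤ x ^ s := by
  have h1 := Nat.floor_le hx
  have h2 := Nat.lt_floor_add_one x
  rw [abs_sub_comm, abs_of_nonneg (by linarith)]
  rcases lt_or_ge x 1 with h | h
  · have : x ≤ x ^ s := by
      rcases hx.eq_or_lt with h0 | h0
      · rw [← h0]; positivity
      · simpa using Real.rpow_le_rpow_of_exponent_ge h0 h.le hs1
    have : (0:ℝ) ≤ (⌊x⌋₊ : ℝ) := by positivity
    linarith
  · have := Real.one_le_rpow h hs0
    linarith

lemma euler_tsum {R : Type*} [NormedField R] (F : ℕ → R) (h1 : F 1 = 1) (p : ℕ)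
    (h3 : ∀ e, F (p ^ (e + 3)) = 0) :
    ∑' e, F (p ^ e) = 1 + F p + F (p ^ 2) := by
  rw [tsum_eq_sum (s := Finset.range 3)]
  · simp [Finset.sum_range_succ, h1]
  · intro b hb
    simp at hb
    obtain ⟨k, rfl⟩ := Nat.exists_eq_add_of_le' hb
    exact h3 k

lemma euler_bound (F : ℕ → ℝ) (hnn : ∀ n, 0 ≤ F n) (h0 : F 0 = 0) (h1 : F 1 = 1)
    (hmul : ∀ {a b : ℕ}, Nat.Coprime a b → F (a * b) = F a * F b)
    (h3 : ∀ p : ℕ, p.Prime → ∀ e, F (p ^ (e + 3)) = 0) (B : ℝ)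
    (hB : ∀ N : ℕ, ∏ p ∈ N.primesBelow, (1 + F p + F (p ^ 2)) ≤ B) :
    Summable F ∧ ∑' n, F n ≤ B := by
  have key : ∀ s : Finset ℕ, ∑ n ∈ s, F n ≤ B := by
    intro s
    set N := s.sup id + 1
    have hs : ∀ {p : ℕ}, p.Prime → Summable (fun n : ℕ ↦ ‖F (p ^ n)‖) := by
      intro p hp
      apply summable_of_ne_finset_zero (s := Finset.range 3)
      intro b hb
      simp at hb
      obtain ⟨k, rfl⟩ := Nat.exists_eq_add_of_le' hb
      simp [h3 p hp k]
    obtain ⟨-, hS⟩ := EulerProduct.summable_and_hasSum_smoothNumbers_prod_primesBelow_tsum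
      h1 hmul hs N
    have e1 : ∏ p ∈ N.primesBelow, ∑' n : ℕ, F (p ^ n) =
        ∏ p ∈ N.primesBelow, (1 + F p + F (p ^ 2)) :=
      Finset.prod_congr rfl fun p hp => euler_tsum F h1 p
        (h3 p (Nat.prime_of_mem_primesBelow hp))
    rw [e1] at hS
    refine le_trans ?_ (hB N)
    have hS' : HasSum (Set.indicator (N.smoothNumbers : Set ℕ) F) _ :=
      (hasSum_subtype_iff_indicator (f := F)).1 hS
    refine le_trans (le_of_eq ?_) (sum_le_hasSum s (fun i _ => Set.indicator_nonneg (fun n _ => hnn n) i) hS')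
    refine Finset.sum_congr rfl fun n hn => ?_
    rcases Nat.eq_zero_or_pos n with rfl | hn0
    · rw [Set.indicator_apply]; simp [h0]
    · rw [Set.indicator_of_mem]
      apply Nat.mem_smoothNumbers_of_lt hn0
      exact Nat.lt_succ_of_le (Finset.le_sup (f := id) hn)
  have hsum := summable_of_sum_le hnn key
  exact ⟨hsum, hsum.tsum_le_of_sum_le key⟩

open ArithmeticFunction in
lemma rankin (h f : ArithmeticFunction ℂ) (hf : h * (zeta : ArithmeticFunction ℂ) = f)
    (s : ℝ) (hs0 : 0 ≤ s) (hs1 : s ≤ 1)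
    (hsum : Summable fun n : ℕ => ‖h n‖ / (n : ℝ) ^ s) (Y : ℝ) (hY : 1 ≤ Y) :
    (Summable fun n : ℕ => ‖h n / (n : ℂ)‖) ∧
    ‖∑ n ∈ Finset.Icc 1 ⌊Y⌋₊, f n - (Y : ℂ) * ∑' n : ℕ, h n / (n : ℂ)‖ ≤
      Y ^ s * ∑' n : ℕ, ‖h n‖ / (n : ℝ) ^ s := by
  have hsum1 : Summable fun n : ℕ => ‖h n / (n : ℂ)‖ := by
    refine Summable.of_nonneg_of_le (fun _ => norm_nonneg _) (fun n => ?_) hsum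
    rcases Nat.eq_zero_or_pos n with rfl | hn0
    · simp
    · rw [norm_div, Complex.norm_natCast]
      gcongr
      simpa using Real.rpow_le_rpow_of_exponent_le (x := n) (by exact_mod_cast hn0) hs1
  refine ⟨hsum1, ?_⟩
  have e1 : ∑ n ∈ Finset.Icc 1 ⌊Y⌋₊, f n = ∑' n : ℕ, h n * ((⌊Y / n⌋₊ : ℝ) : ℂ) := by
    rw [← hf, tsum_eq_sum (s := Finset.Ioc 0 ⌊Y⌋₊)]
    · have := sum_Ioc_mul_zeta_eq_sum h ⌊Y⌋₊
      rw [show Finset.Icc 1 ⌊Y⌋₊ = Finset.Ioc 0 ⌊Y⌋₊ from rfl, this]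
      refine Finset.sum_congr rfl fun n hn => ?_
      rw [Nat.floor_div_natCast]
      simp
    · intro b hb
      rcases Nat.eq_zero_or_pos b with rfl | hn0
      · simp
      · have : ⌊Y / b⌋₊ = 0 := by
          rw [Nat.floor_div_natCast]
          apply Nat.div_eq_of_lt
          simp at hb
          exact hb hn0
        simp [this]
  have hb : ∀ n : ℕ, ‖h n * ((⌊Y / n⌋₊ : ℝ) : ℂ) - Y * (h n / (n : ℂ))‖ ≤
      Y ^ s * (‖h n‖ / (n : ℝ) ^ s) := by
    intro n
    have : h n * ((⌊Y / n⌋₊ : ℝ) : ℂ) - Y * (h n / (n : ℂ)) =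
        h n * (((⌊Y / n⌋₊ : ℝ) - Y / n : ℝ) : ℂ) := by
      push_cast; ring
    rw [this, norm_mul, Complex.norm_real, Real.norm_eq_abs]
    have hY0 : 0 ≤ Y := by linarith
    calc _ ≤ ‖h n‖ * (Y / n) ^ s := by
            gcongr
            exact floor_sub_bound _ _ (by positivity) hs0 hs1
      _ = _ := by rw [Real.div_rpow hY0 (by positivity)]; ring
  have hs2 := hsum.mul_left (Y ^ s)
  have hs3 : Summable fun n : ℕ => h n * ((⌊Y / n⌋₊ : ℝ) : ℂ) - Y * (h n / (n : ℂ)) :=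
    Summable.of_norm_bounded hs2 hb
  have hs4 : Summable fun n : ℕ => (Y : ℂ) * (h n / (n : ℂ)) := hsum1.of_norm.mul_left _
  have hs5 : Summable fun n : ℕ => h n * ((⌊Y / n⌋₊ : ℝ) : ℂ) := by
    simpa using hs3.add hs4
  rw [e1, ← tsum_mul_left, ← hs5.tsum_sub hs4, ← tsum_mul_left]
  exact tsum_of_norm_bounded hs2.hasSum hb

open scoped Classical in
/-- The arithmetic function supported on squarefree integers coprime to m. -/
noncomputable def fA (g : ℕ → ℂ) (m : ℕ) : ArithmeticFunction ℂ :=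
  ⟨fun n => if Squarefree n ∧ Nat.gcd n m = 1 then g n else 0, by simp⟩

lemma fA_apply (g : ℕ → ℂ) (m n : ℕ) [Decidable (Squarefree n ∧ Nat.gcd n m = 1)] :
    fA g m n = if Squarefree n ∧ Nat.gcd n m = 1 then g n else 0 := by
  simp only [fA, ArithmeticFunction.coe_mk]
  congr

lemma fA_mult (g : ℕ → ℂ) (m : ℕ) (h1 : g 1 = 1)
    (hmul : ∀ a b : ℕ, Nat.Coprime a b → g (a * b) = g a * g b) :
    (fA g m).IsMultiplicative := by
  classical
  refine ⟨by simp [fA_apply, h1], fun {a b} hab => ?_⟩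
  simp only [fA_apply, Nat.squarefree_mul_iff, ← Nat.coprime_iff_gcd_eq_one,
    Nat.coprime_mul_iff_left, hmul a b hab]
  rw [ite_zero_mul_ite_zero]
  refine if_congr ?_ rfl rfl
  tauto

open ArithmeticFunction in
/-- The Dirichlet quotient by zeta. -/
noncomputable def hQ (g : ℕ → ℂ) (m : ℕ) : ArithmeticFunction ℂ :=
  fA g m * ((moebius : ArithmeticFunction ℤ) : ArithmeticFunction ℂ)

open ArithmeticFunction in
lemma hA_zeta (g : ℕ → ℂ) (m : ℕ) :
    hQ g m * ((zeta : ArithmeticFunction ℕ) : ArithmeticFunction ℂ) = fA g m := by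
  rw [hQ, mul_assoc, coe_moebius_mul_coe_zeta, mul_one]

lemma hA_mult (g : ℕ → ℂ) (m : ℕ) (h1 : g 1 = 1)
    (hmul : ∀ a b : ℕ, Nat.Coprime a b → g (a * b) = g a * g b) :
    (hQ g m).IsMultiplicative :=
  (fA_mult g m h1 hmul).mul ArithmeticFunction.isMultiplicative_moebius.intCast

lemma hA_pow (g : ℕ → ℂ) (m p e : ℕ) (hp : p.Prime) :
    hQ g m (p ^ (e + 1)) = fA g m (p ^ (e + 1)) - fA g m (p ^ e) := by
  have key : ∀ k, fA g m (p ^ k) = ∑ i ∈ Finset.range (k + 1), hQ g m (p ^ i) := by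
    intro k
    rw [← hA_zeta, ArithmeticFunction.coe_mul_zeta_apply, Nat.sum_divisors_prime_pow hp]
  rw [key, key, Finset.sum_range_succ _ (e + 1)]
  ring

lemma fA_pow (g : ℕ → ℂ) (m p e : ℕ) (hp : p.Prime) : fA g m (p ^ (e + 2)) = 0 := by
  classical
  rw [fA_apply, if_neg]
  rintro ⟨h, -⟩
  exact hp.not_isUnit (h p ⟨p ^ e, by ring⟩)

lemma fA_p (g : ℕ → ℂ) (m p : ℕ) (hp : p.Prime) : fA g m p = if p ∣ m then 0 else g p := by
  classical
  rw [fA_apply]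
  by_cases h : p ∣ m
  · rw [if_pos h, if_neg]
    rintro ⟨-, h2⟩
    exact (hp.coprime_iff_not_dvd.mp h2) h
  · rw [if_neg h, if_pos ⟨hp.squarefree, hp.coprime_iff_not_dvd.mpr h⟩]

lemma hA_p (g : ℕ → ℂ) (m p : ℕ) (h1 : g 1 = 1) (hp : p.Prime) :
    hQ g m p = if p ∣ m then -1 else g p - 1 := by
  classical
  have := hA_pow g m p 0 hp
  simp only [zero_add, pow_one, pow_zero] at this
  rw [this, fA_p _ _ _ hp]
  have : fA g m 1 = 1 := by simp [fA_apply, h1]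
  rw [this]; split_ifs <;> ring

lemma hA_p2 (g : ℕ → ℂ) (m p : ℕ) (hp : p.Prime) :
    hQ g m (p ^ 2) = if p ∣ m then 0 else - g p := by
  rw [hA_pow g m p 1 hp, fA_pow g m p 0 hp, pow_one, fA_p _ _ _ hp]
  split_ifs <;> simp

lemma hA_p3 (g : ℕ → ℂ) (m p e : ℕ) (hp : p.Prime) :
    hQ g m (p ^ (e + 3)) = 0 := by
  rw [hA_pow g m p (e + 2) hp, fA_pow g m p e hp]
  have := fA_pow g m p (e + 1) hp
  rw [show e + 2 + 1 = e + 1 + 2 by ring, this, sub_zero]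

lemma norm_g_le (A : ℝ) (hA : 0 < A) (g : ℕ → ℂ)
    (hg : ∀ p : ℕ, p.Prime → ‖g p - 1‖ ≤ A / p) (p : ℕ) (hp : p.Prime) : ‖g p‖ ≤ 1 + A := by
  have h1 : (1 : ℝ) ≤ p := by exact_mod_cast hp.one_lt.le
  have h2 : A / p ≤ A := div_le_self hA.le h1
  have h3 := hg p hp
  have h4 : ‖g p‖ ≤ ‖g p - 1‖ + ‖(1 : ℂ)‖ := by
    simpa using norm_add_le (g p - 1) 1
  rw [norm_one] at h4
  linarith

lemma main_bound (A : ℝ) (hA0 : 0 < A) (e : ℝ) (he : 0 < e) (he1 : e ≤ 1 / 4) :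
    ∃ C : ℝ, 0 < C ∧ ∀ g : ℕ → ℂ, g 1 = 1 →
      (∀ a b : ℕ, Nat.Coprime a b → g (a * b) = g a * g b) →
      (∀ p : ℕ, p.Prime → ‖g p - 1‖ ≤ A / p) → ∀ m : ℕ, 1 ≤ m →
      (Summable fun n : ℕ => ‖hQ g m n‖ / (n : ℝ) ^ (1 / 2 + e)) ∧
      ∑' n : ℕ, ‖hQ g m n‖ / (n : ℝ) ^ (1 / 2 + e) ≤ C * (m : ℝ) ^ e := by
  obtain ⟨K, hK, hKm⟩ := two_prod_bound e he
  have hz : Summable fun n : ℕ => (2 * A + 1) * (1 / (n : ℝ) ^ (1 + 2 * e)) :=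
    (Real.summable_one_div_nat_rpow.mpr (by linarith)).mul_left _
  set b : ℕ → ℝ := fun n => (2 * A + 1) * (1 / (n : ℝ) ^ (1 + 2 * e)) with hb
  have hbnn : ∀ n, 0 ≤ b n := fun n => by positivity
  refine ⟨K * Real.exp (∑' n, b n), by positivity, fun g h1 hmul hg m hm => ?_⟩
  have hM := hA_mult g m h1 hmul
  apply euler_bound
  · intro n; positivity
  · simp
  · simp [hM.1]
  · intro x y hxy
    rw [hM.2 hxy, norm_mul]
    push_cast
    rw [Real.mul_rpow (by positivity) (by positivity)]
    ring
  · intro p hp k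
    simp [hA_p3 g m p k hp]
  · intro N
    have step : ∀ p ∈ N.primesBelow, 1 + ‖hQ g m p‖ / (p : ℝ) ^ (1 / 2 + e) +
        ‖hQ g m (p ^ 2)‖ / ((p ^ 2 : ℕ) : ℝ) ^ (1 / 2 + e) ≤
        (if p ∣ m then 2 else 1) * Real.exp (b p) := by
      intro p hp
      have hpp := Nat.prime_of_mem_primesBelow hp
      have hp1 : (1 : ℝ) ≤ p := by exact_mod_cast hpp.one_lt.le
      have hp0 : (0 : ℝ) < p := by linarith
      rw [hA_p g m p h1 hpp, hA_p2 g m p hpp]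
      split_ifs with h
      · have t1 : 1 ≤ (p : ℝ) ^ (1 / 2 + e) := Real.one_le_rpow hp1 (by linarith)
        have t2 : 1 / (p : ℝ) ^ (1 / 2 + e) ≤ 1 := by
          rw [div_le_one (by linarith)]; exact t1
        have t3 : 1 ≤ Real.exp (b p) := Real.one_le_exp (hbnn p)
        simp only [norm_neg, norm_one, norm_zero, zero_div]
        linarith
      · rw [one_mul]
        refine le_trans ?_ (Real.add_one_le_exp (b p))
        have t1 : ‖g p - 1‖ / (p : ℝ) ^ (1 / 2 + e) ≤ A * (1 / (p : ℝ) ^ (1 + 2 * e)) := by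
          calc _ ≤ (A / p) / (p : ℝ) ^ (1 / 2 + e) := by gcongr; exact hg p hpp
            _ = A * (1 / (p : ℝ) ^ (1 + (1 / 2 + e))) := by
                rw [Real.rpow_add hp0 1, Real.rpow_one]; field_simp
            _ ≤ _ := by
                gcongr 3
                linarith
        have t2 : ‖-g p‖ / ((p ^ 2 : ℕ) : ℝ) ^ (1 / 2 + e) ≤
            (1 + A) * (1 / (p : ℝ) ^ (1 + 2 * e)) := by
          have : ((p ^ 2 : ℕ) : ℝ) ^ (1 / 2 + e) = (p : ℝ) ^ (1 + 2 * e) := by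
            push_cast
            rw [← Real.rpow_natCast, ← Real.rpow_mul hp0.le]
            congr 1; push_cast; ring
          rw [this, norm_neg, mul_one_div]
          gcongr
          exact norm_g_le A hA0 g hg p hpp
        simp only [hb]
        linarith
    refine (Finset.prod_le_prod (fun p _ => by positivity) step).trans ?_
    rw [Finset.prod_mul_distrib, ← Real.exp_sum, mul_right_comm]
    have u1 : ∏ p ∈ N.primesBelow, (if p ∣ m then (2 : ℝ) else 1) ≤ K * (m : ℝ) ^ e := by
      refine le_trans ?_ (hKm m hm)
      rw [Finset.prod_ite]
      simp only [Finset.prod_const, one_pow, mul_one]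
      apply pow_le_pow_right₀ (by norm_num)
      apply Finset.card_le_card
      intro p hp
      rw [Finset.mem_filter] at hp
      exact Nat.mem_primeFactors.mpr ⟨Nat.prime_of_mem_primesBelow hp.1, hp.2, by omega⟩
    have u2 : ∑ p ∈ N.primesBelow, b p ≤ ∑' n, b n := hz.sum_le_tsum _ (fun n _ => hbnn n)
    gcongr

lemma main_term (A : ℝ) (hA0 : 0 < A) (g : ℕ → ℂ) (h1 : g 1 = 1)
    (hmul : ∀ a b : ℕ, Nat.Coprime a b → g (a * b) = g a * g b)
    (hg : ∀ p : ℕ, p.Prime → ‖g p - 1‖ ≤ A / p) (m : ℕ) (hm : 1 ≤ m)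
    (hsum : Summable fun n : ℕ => ‖hQ g m n / (n : ℂ)‖) :
    ∑' n : ℕ, hQ g m n / (n : ℂ) = (∏ p ∈ m.primeFactors, (1 - 1 / (p : ℂ))) *
      ∏' p : {p : Nat.Primes // ¬ (p : ℕ) ∣ m},
        ((1 - 1 / ((p.1 : ℕ) : ℂ)) * (1 + g (p.1 : ℕ) / ((p.1 : ℕ) : ℂ))) := by
  have hM := hA_mult g m h1 hmul
  have hE := EulerProduct.eulerProduct_hasProd (f := fun n : ℕ => hQ g m n / (n : ℂ))
    (by simp [hM.1]) (by
      intro x y hxy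
      simp only [hM.2 hxy]
      push_cast
      rw [mul_div_mul_comm]) hsum (by simp)
  set P : Nat.Primes → ℂ := fun p => if (p : ℕ) ∣ m then 1 - 1 / ((p : ℕ) : ℂ) else
    (1 - 1 / ((p : ℕ) : ℂ)) * (1 + g (p : ℕ) / ((p : ℕ) : ℂ)) with hP
  have e1 : (fun p : Nat.Primes => ∑' e, hQ g m ((p : ℕ) ^ e) / (((p : ℕ) ^ e : ℕ) : ℂ)) = P := by
    funext p
    rw [euler_tsum (fun n : ℕ => hQ g m n / (n : ℂ)) (by simp [hM.1]) p
      (fun e => by simp [hA_p3 g m p e p.2]), hP, hA_p g m p h1 p.2, hA_p2 g m p p.2]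
    have : ((p : ℕ) : ℂ) ≠ 0 := by exact_mod_cast p.2.ne_zero
    dsimp only
    push_cast
    split_ifs
    · ring
    · field_simp; ring
  rw [e1] at hE
  refine hE.unique ?_
  set S : Set Nat.Primes := {p | (p : ℕ) ∣ m} with hS
  have hfin : HasProd (P ∘ (↑) : S → ℂ) (∏ p ∈ m.primeFactors, (1 - 1 / (p : ℂ))) := by
    set T : Finset Nat.Primes := m.primeFactors.attach.map
      ⟨fun p => ⟨p.1, Nat.prime_of_mem_primeFactors p.2⟩, fun a b h => by
        exact Subtype.ext (congrArg (fun q : Nat.Primes => (q : ℕ)) h)⟩ with hT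
    have hTS : (T : Set Nat.Primes) = S := by
      ext p
      simp only [hT, hS, Finset.coe_map, Set.mem_image, Set.mem_ofPred_eq]
      constructor
      · rintro ⟨a, -, rfl⟩
        exact Nat.dvd_of_mem_primeFactors a.2
      · intro h
        exact ⟨⟨p, Nat.mem_primeFactors.mpr ⟨p.2, h, by omega⟩⟩, by simp, rfl⟩
    have := T.hasProd P
    rw [← hTS]
    convert this using 1
    rw [hT, Finset.prod_map, ← Finset.prod_attach]
    refine Finset.prod_congr rfl fun p _ => ?_
    exact (if_pos (Nat.dvd_of_mem_primeFactors p.2)).symm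
  have hinf : HasProd (P ∘ (↑) : ↑Sᶜ → ℂ) (∏' p : {p : Nat.Primes // ¬ (p : ℕ) ∣ m},
        ((1 - 1 / ((p.1 : ℕ) : ℂ)) * (1 + g (p.1 : ℕ) / ((p.1 : ℕ) : ℂ)))) := by
    have hmult : Multipliable fun p : {p : Nat.Primes // ¬ (p : ℕ) ∣ m} =>
        ((1 - 1 / ((p.1 : ℕ) : ℂ)) * (1 + g (p.1 : ℕ) / ((p.1 : ℕ) : ℂ))) := by
      have hz : Summable fun n : ℕ => (2 * A + 1) * (1 / (n : ℝ) ^ 2) :=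
        (Real.summable_one_div_nat_pow.mpr (by norm_num)).mul_left _
      have hinj : Function.Injective
          (fun p : {p : Nat.Primes // ¬ (p : ℕ) ∣ m} => (p.1 : ℕ)) := by
        intro a b h
        exact Subtype.ext (Subtype.ext h)
      have hz2 := hz.comp_injective hinj
      have : (fun p : {p : Nat.Primes // ¬ (p : ℕ) ∣ m} =>
        ((1 - 1 / ((p.1 : ℕ) : ℂ)) * (1 + g (p.1 : ℕ) / ((p.1 : ℕ) : ℂ)))) = fun p =>
          1 + ((g (p.1 : ℕ) - 1) / ((p.1 : ℕ) : ℂ) - g (p.1 : ℕ) / ((p.1 : ℕ) : ℂ) ^ 2) := by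
        funext p
        ring
      rw [this]
      apply multipliable_one_add_of_summable
      refine Summable.of_nonneg_of_le (fun _ => norm_nonneg _) (fun p => ?_) hz2
      have hp := p.1.2
      simp only [Function.comp]
      generalize (p.1 : ℕ) = q at hp
      have hp1 : (1 : ℝ) ≤ q := by exact_mod_cast hp.one_lt.le
      have hp0 : (0 : ℝ) < q := by linarith
      refine (norm_sub_le _ _).trans ?_
      rw [norm_div, norm_div, norm_pow, Complex.norm_natCast]
      calc _ ≤ (A / q) / q + (1 + A) / (q : ℝ) ^ 2 := by
            gcongr
            · exact hg q hp
            · exact norm_g_le A hA0 g hg q hp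
        _ = _ := by field_simp; ring
    have e2 : (P ∘ (↑) : {p : Nat.Primes // ¬ (p : ℕ) ∣ m} → ℂ) = fun p =>
        ((1 - 1 / ((p.1 : ℕ) : ℂ)) * (1 + g (p.1 : ℕ) / ((p.1 : ℕ) : ℂ))) := by
      funext p
      exact if_neg p.2
    have h3 := hmult.hasProd
    rw [← e2] at h3 ⊢
    exact h3
  exact hfin.mul_compl hinf

open scoped Classical in
theorem statement_4 (A : ℝ) (hA : 0 < A) (ε : ℝ) (hε : 0 < ε) :
    ∃ C : ℝ, 0 < C ∧
      ∀ g : ℕ → ℂ, g 1 = 1 →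
        (∀ a b : ℕ, Nat.Coprime a b → g (a * b) = g a * g b) →
        (∀ p : ℕ, p.Prime → ‖g p - 1‖ ≤ A / p) →
        ∀ m : ℕ, 1 ≤ m → ∀ Y : ℝ, 2 ≤ Y →
          ‖(∑ n ∈ Finset.Icc 1 ⌊Y⌋₊, if Squarefree n ∧ Nat.gcd n m = 1 then g n else 0)
              - (Y : ℂ) * (∏ p ∈ m.primeFactors, (1 - 1 / (p : ℂ))) *
                ∏' p : {p : Nat.Primes // ¬ (p : ℕ) ∣ m},
                  ((1 - 1 / ((p.1 : ℕ) : ℂ)) * (1 + g (p.1 : ℕ) / ((p.1 : ℕ) : ℂ)))‖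
            ≤ C * (m : ℝ) ^ ε * Y ^ ((1 : ℝ) / 2 + ε) := by
  have he : 0 < min ε (1 / 4) := lt_min hε (by norm_num)
  have he1 : min ε (1 / 4) ≤ 1 / 4 := min_le_right _ _
  have he2 : min ε (1 / 4) ≤ ε := min_le_left _ _
  generalize min ε (1 / 4) = e at he he1 he2
  obtain ⟨C, hC, hCb⟩ := main_bound A hA e he he1
  refine ⟨C, hC, fun g h1 hmul hg m hm Y hY => ?_⟩
  obtain ⟨hs, hle⟩ := hCb g h1 hmul hg m hm
  obtain ⟨hs1, hr⟩ := rankin (hQ g m) (fA g m) (hA_zeta g m) (1 / 2 + e) (by linarith)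
    (by linarith) hs Y (by linarith)
  rw [main_term A hA g h1 hmul hg m hm hs1, ← mul_assoc] at hr
  simp only [fA_apply] at hr
  refine hr.trans ?_
  have hY1 : 1 ≤ Y := by linarith
  have hm1 : (1 : ℝ) ≤ m := by exact_mod_cast hm
  calc _ ≤ Y ^ (1 / 2 + e) * (C * (m : ℝ) ^ e) := by gcongr
    _ ≤ Y ^ (1 / 2 + ε) * (C * (m : ℝ) ^ ε) := by gcongr
    _ = _ := by ring
end

section
/- Let M be a number field that is Galois over ℚ with Galois group isomorphic to (ℤ/2ℤ)², let J be the set of quadratic subfields of M that are totally real, and for each K ∈ J let ε_K ∈ O_K^× be a unit of infinite order (not a root of unity). Then: (i) if (c_K)_{K ∈ J} are integers such that ∏_{K ∈ J} ε_K^{c_K} is a root of unity in M, then c_K = 0 for all K; consequently the subgroup of O_M^× generated by {ε_K : K ∈ J} is free abelian of rank #J; and (ii) #J = r_M + s_M − 1, where r_M and s_M are the numbers of real and complex places of M. -/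
open NumberField

section helpers

theorem aux_group {G : Type*} [Group G]
    (h : Nonempty (G ≃* (Multiplicative (ZMod 2) × Multiplicative (ZMod 2)))) :
    Nat.card G = 4 ∧ (∀ a b : G, a * b = b * a) ∧ ∀ a : G, a * a = 1 := by
  obtain ⟨e⟩ := h
  refine ⟨?_, ?_, ?_⟩
  · rw [Nat.card_congr e.toEquiv, Nat.card_prod]
    simp [Nat.card_eq_fintype_card, ZMod.card]
  · intro a b
    apply e.injective
    rw [map_mul, map_mul, mul_comm]
  · intro a
    apply e.injective
    rw [map_mul, map_one]
    generalize e a = x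
    revert x
    decide

variable {M : Type*} [Field M] [NumberField M] [IsGalois ℚ M]

theorem aux_fix (h4 : Nat.card (M ≃ₐ[ℚ] M) = 4) (K : IntermediateField ℚ M)
    (hK : Module.finrank ℚ K = 2) :
    ∃ h : M ≃ₐ[ℚ] M, h ≠ 1 ∧ ∀ g, g ∈ K.fixingSubgroup ↔ g = 1 ∨ g = h := by
  have h1 : Nat.card K.fixingSubgroup = 2 := by
    rw [IsGalois.card_fixingSubgroup_eq_finrank]
    have := Module.finrank_mul_finrank ℚ K M
    rw [IsGalois.card_aut_eq_finrank] at h4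
    rw [hK, h4] at this
    omega
  obtain ⟨y, hy, hy2⟩ := (Nat.card_eq_two_iff' (1 : K.fixingSubgroup)).1 h1
  refine ⟨y, ?_, ?_⟩
  · intro h
    exact hy (Subtype.ext h)
  · intro g
    constructor
    · intro hg
      by_cases h : g = 1
      · exact Or.inl h
      · right
        have := hy2 ⟨g, hg⟩ (fun h' => h (congrArg Subtype.val h'))
        exact congrArg Subtype.val this
    · rintro (rfl | rfl)
      · exact one_mem _
      · exact y.2

/-- a unit all of whose conjugates agree up to torsion -/
theorem aux_fixed_torsion (h4 : Nat.card (M ≃ₐ[ℚ] M) = 4) (u : (𝓞 M)ˣ)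
    (hu : ∀ g : M ≃ₐ[ℚ] M, g ((u : 𝓞 M) : M) = ((u : 𝓞 M) : M)) : u ^ 8 = 1 := by
  have h1 := Algebra.norm_eq_prod_automorphisms (K := ℚ) ((u : 𝓞 M) : M)
  have h2 : |Algebra.norm ℚ ((u : 𝓞 M) : M)| = 1 := NumberField.Units.norm M u
  simp only [hu, Finset.prod_const, Finset.card_univ] at h1
  rw [← Nat.card_eq_fintype_card, h4] at h1
  have h3 : (Algebra.norm ℚ ((u : 𝓞 M) : M)) ^ 2 = 1 := by
    rw [← sq_abs, h2, one_pow]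
  ext
  push_cast
  have h5 : (((u : 𝓞 M) : M)) ^ 8 = ((((u : 𝓞 M) : M)) ^ 4) ^ 2 := by ring
  rw [h5, ← h1, ← map_pow, h3, map_one]

/-- action on units -/
noncomputable def act (g : M ≃ₐ[ℚ] M) : (𝓞 M)ˣ →* (𝓞 M)ˣ :=
  Units.map (RingOfIntegers.mapRingHom (g : M →+* M) : 𝓞 M →* 𝓞 M)

theorem act_coe (g : M ≃ₐ[ℚ] M) (u : (𝓞 M)ˣ) : ((act g u : 𝓞 M) : M) = g ((u : 𝓞 M) : M) := rfl

theorem aux_pair (h4 : Nat.card (M ≃ₐ[ℚ] M) = 4)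
    (hcomm : ∀ a b : M ≃ₐ[ℚ] M, a * b = b * a) (hsq : ∀ a : M ≃ₐ[ℚ] M, a * a = 1)
    (K : IntermediateField ℚ M) (hK : Module.finrank ℚ K = 2) (u : (𝓞 M)ˣ)
    (hu : ((u : 𝓞 M) : M) ∈ K) (s : M ≃ₐ[ℚ] M) (hs : s ∉ K.fixingSubgroup) :
    (u * act s u) ^ 8 = 1 := by
  have hss : ∀ x, s (s x) = x := fun x => by
    rw [← AlgEquiv.mul_apply, hsq, AlgEquiv.one_apply]
  have hc : ∀ (g : M ≃ₐ[ℚ] M) x, g (s x) = s (g x) := fun g x => by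
    rw [← AlgEquiv.mul_apply, hcomm, AlgEquiv.mul_apply]
  have hidx : K.fixingSubgroup.index = 2 := by
    have h1 := K.fixingSubgroup.card_mul_index
    obtain ⟨h, hh, hf⟩ := aux_fix h4 K hK
    have h2 : Nat.card K.fixingSubgroup = 2 := by
      rw [IsGalois.card_fixingSubgroup_eq_finrank]
      have := Module.finrank_mul_finrank ℚ K M
      have h4' := h4
      rw [IsGalois.card_aut_eq_finrank] at h4'
      rw [hK, h4'] at this
      omega
    rw [h2, h4] at h1
    omega
  apply aux_fixed_torsion h4
  intro g
  have e : (((u * act s u : (𝓞 M)ˣ) : 𝓞 M) : M) = ((u : 𝓞 M) : M) * s ((u : 𝓞 M) : M) := rfl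
  rw [e, map_mul]
  by_cases hg : g ∈ K.fixingSubgroup
  · have := (IntermediateField.mem_fixingSubgroup_iff K g).1 hg _ hu
    rw [hc, this]
  · have h1 : g * s ∈ K.fixingSubgroup := by
      rw [Subgroup.mul_mem_iff_of_index_two hidx]
      tauto
    have h2 := (IntermediateField.mem_fixingSubgroup_iff K _).1 h1 _ hu
    rw [AlgEquiv.mul_apply] at h2
    rw [h2, mul_comm]
    congr 1
    rw [← hss (g _), ← hc g, h2]

theorem aux_indep (h4 : Nat.card (M ≃ₐ[ℚ] M) = 4)
    (hcomm : ∀ a b : M ≃ₐ[ℚ] M, a * b = b * a) (hsq : ∀ a : M ≃ₐ[ℚ] M, a * a = 1)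
    (J : Set (IntermediateField ℚ M)) [Fintype J]
    (hJ : ∀ K ∈ J, Module.finrank ℚ K = 2)
    (ε : J → (𝓞 M)ˣ)
    (hmem : ∀ K : J, ((ε K : 𝓞 M) : M) ∈ (K : IntermediateField ℚ M))
    (hinf : ∀ (K : J) (n : ℕ), 1 ≤ n → (ε K) ^ n ≠ 1) (c : J → ℤ)
    (hc : ∃ n : ℕ, 1 ≤ n ∧ (∏ K : J, (ε K) ^ (c K)) ^ n = 1) (K : J) : c K = 0 := by
  classical
  obtain ⟨n, hn, hu⟩ := hc
  obtain ⟨h, hh1, hh⟩ := aux_fix h4 K (hJ K K.2)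
  have hfix : act h (ε K) = ε K := by
    ext
    rw [act_coe]
    exact (IntermediateField.mem_fixingSubgroup_iff _ h).1 ((hh h).2 (Or.inr rfl)) _ (hmem K)
  have hoth : ∀ L : J, L ≠ K → (ε L * act h (ε L)) ^ 8 = 1 := by
    intro L hL
    apply aux_pair h4 hcomm hsq L (hJ L L.2) _ (hmem L)
    intro hm
    apply hL
    obtain ⟨k, hk1, hk⟩ := aux_fix h4 L (hJ L L.2)
    have hhk : h = k := ((hk h).1 hm).resolve_left hh1
    have : (L : IntermediateField ℚ M).fixingSubgroup =
        (K : IntermediateField ℚ M).fixingSubgroup := by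
      ext g
      rw [hk, hh, hhk]
    apply Subtype.ext
    rw [← IsGalois.fixedField_fixingSubgroup (L : IntermediateField ℚ M), this,
      IsGalois.fixedField_fixingSubgroup]
  set u := ∏ K : J, (ε K) ^ (c K) with hudef
  have e1 : (u * act h u) ^ 8 = (ε K) ^ (16 * c K) := by
    have e2 : u * act h u = ∏ L : J, (ε L * act h (ε L)) ^ (c L) := by
      rw [hudef, map_prod, ← Finset.prod_mul_distrib]
      refine Finset.prod_congr rfl fun L _ => ?_
      rw [map_zpow, mul_zpow]
    rw [e2, ← Finset.prod_pow, Finset.prod_eq_single K]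
    · rw [hfix, ← zpow_natCast, ← zpow_mul, mul_zpow, ← zpow_add]
      congr 1
      push_cast
      ring
    · intro L _ hL
      rw [← zpow_natCast, ← zpow_mul, mul_comm (c L), zpow_mul, zpow_natCast, hoth L hL, one_zpow]
    · intro hK
      exact absurd (Finset.mem_univ K) hK
  have e3 : (ε K) ^ ((16 * c K) * n) = 1 := by
    rw [zpow_mul, ← e1, zpow_natCast, ← pow_mul, mul_comm 8 n, pow_mul, mul_pow, ← map_pow, hu,
      map_one, one_mul, one_pow]
  by_contra hne
  have hfo : IsOfFinOrder (ε K) := by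
    rw [isOfFinOrder_iff_zpow_eq_one]
    exact ⟨_, by
      have : (n : ℤ) ≠ 0 := by omega
      positivity, e3⟩
  obtain ⟨m, hm, hm1⟩ := isOfFinOrder_iff_pow_eq_one.1 hfo
  exact hinf K m hm hm1

theorem aux_free {A ι : Type*} [CommGroup A] [Fintype ι] (ε : ι → A)
    (h : ∀ c : ι → ℤ, ∏ i, ε i ^ c i = 1 → ∀ i, c i = 0) :
    Nonempty (Subgroup.closure (Set.range ε) ≃* Multiplicative (ι →₀ ℤ)) := by
  classical
  let f : Multiplicative (ι →₀ ℤ) →* A :=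
    { toFun := fun c => ∏ i, ε i ^ (c.toAdd i)
      map_one' := by simp
      map_mul' := fun a b => by
        simp [zpow_add, Finset.prod_mul_distrib] }
  have hf : ∀ c : Multiplicative (ι →₀ ℤ), f c = ∏ i, ε i ^ (c.toAdd i) := fun _ => rfl
  have hinj : Function.Injective f := by
    rw [injective_iff_map_eq_one]
    intro c hc
    have := h _ hc
    apply Multiplicative.toAdd.injective
    ext i
    exact this i
  have hr : f.range = Subgroup.closure (Set.range ε) := by
    apply le_antisymm
    · rintro _ ⟨c, rfl⟩
      rw [hf]
      exact Subgroup.prod_mem _ fun i _ =>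
        Subgroup.zpow_mem _ (Subgroup.subset_closure (Set.mem_range_self i)) _
    · rw [Subgroup.closure_le]
      rintro _ ⟨i, rfl⟩
      refine ⟨Multiplicative.ofAdd (Finsupp.single i 1), ?_⟩
      rw [hf, Finset.prod_eq_single i]
      · simp
      · intro j _ hj
        simp [Finsupp.single_apply, hj.symm]
      · simp
  exact ⟨((MonoidHom.ofInjective hinj).trans (MulEquiv.subgroupCongr hr)).symm⟩

theorem aux_conj (φ : M →+* ℂ) :
    ∃ c : M ≃ₐ[ℚ] M, ∀ x, φ (c x) = (starRingEnd ℂ) (φ x) := by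
  obtain ⟨s, hs⟩ := InfinitePlace.ComplexEmbedding.exists_comp_symm_eq_of_comp_eq (k := ℚ) φ
    (ComplexEmbedding.conjugate φ) (Subsingleton.elim _ _)
  exact ⟨s.symm, fun x => RingHom.congr_fun hs x⟩

theorem aux_real (hcomm : ∀ a b : M ≃ₐ[ℚ] M, a * b = b * a) (φ : M →+* ℂ) (c : M ≃ₐ[ℚ] M)
    (hc : ∀ x, φ (c x) = (starRingEnd ℂ) (φ x)) (K : IntermediateField ℚ M) :
    Nonempty (K →+* ℝ) ↔ c ∈ K.fixingSubgroup := by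
  rw [IntermediateField.mem_fixingSubgroup_iff]
  constructor
  · rintro ⟨ψ⟩ x hx
    let ψ' : M →+* ℂ := ComplexEmbedding.lift M ((algebraMap ℝ ℂ).comp ψ)
    obtain ⟨s, hs⟩ := InfinitePlace.ComplexEmbedding.exists_comp_symm_eq_of_comp_eq (k := ℚ) φ ψ'
      (Subsingleton.elim _ _)
    have h1 : φ (s.symm x) = (ψ ⟨x, hx⟩ : ℂ) := by
      have e1 : φ (s.symm x) = ψ' x := RingHom.congr_fun hs x
      rw [e1]
      exact ComplexEmbedding.lift_algebraMap_apply M ((algebraMap ℝ ℂ).comp ψ) ⟨x, hx⟩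
    have h2 := hc (s.symm x)
    rw [h1, Complex.conj_ofReal, ← h1] at h2
    have h3 := φ.injective h2
    have h4 : c (s.symm x) = s.symm (c x) := by
      have := hcomm c s.symm
      exact DFunLike.congr_fun this x
    rw [h4] at h3
    exact s.symm.injective h3
  · intro h
    have : ComplexEmbedding.IsReal (φ.comp (algebraMap K M)) := by
      rw [ComplexEmbedding.isReal_iff]
      ext x
      have := hc x
      rw [h x x.2] at this
      exact this.symm
    exact ⟨this.embedding⟩

theorem aux_count (h4 : Nat.card (M ≃ₐ[ℚ] M) = 4) (hsq : ∀ a : M ≃ₐ[ℚ] M, a * a = 1)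
    (c : M ≃ₐ[ℚ] M) :
    Nat.card {K : IntermediateField ℚ M | Module.finrank ℚ K = 2 ∧ c ∈ K.fixingSubgroup} =
    Set.ncard {h : M ≃ₐ[ℚ] M | h ≠ 1 ∧ (c = 1 ∨ c = h)} := by
  let f : (M ≃ₐ[ℚ] M) → IntermediateField ℚ M := fun h =>
    IntermediateField.fixedField (Subgroup.zpowers h)
  have hf : ∀ h, (f h).fixingSubgroup = Subgroup.zpowers h := fun h =>
    IntermediateField.fixingSubgroup_fixedField _
  have hz : ∀ h g : M ≃ₐ[ℚ] M, g ∈ Subgroup.zpowers h ↔ g = 1 ∨ g = h := by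
    intro h g
    constructor
    · rintro ⟨n, rfl⟩
      have h2 : h ^ (2 : ℤ) = 1 := by rw [zpow_two, hsq]
      rcases Int.even_or_odd' n with ⟨k, rfl | rfl⟩
      · left
        simp [zpow_mul, h2]
      · right
        simp [zpow_add, zpow_mul, h2]
    · rintro (rfl | rfl)
      · exact one_mem _
      · exact Subgroup.mem_zpowers _
  have himg : {K : IntermediateField ℚ M | Module.finrank ℚ K = 2 ∧ c ∈ K.fixingSubgroup} =
      f '' {h : M ≃ₐ[ℚ] M | h ≠ 1 ∧ (c = 1 ∨ c = h)} := by
    ext K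
    simp only [Set.mem_setOf_eq, Set.mem_image]
    constructor
    · rintro ⟨hK, hcK⟩
      obtain ⟨h, h1, hh⟩ := aux_fix h4 K hK
      refine ⟨h, ⟨h1, (hh c).1 hcK⟩, ?_⟩
      have : K.fixingSubgroup = Subgroup.zpowers h := by
        ext g
        rw [hh, hz]
      change IntermediateField.fixedField _ = K
      rw [← this, IsGalois.fixedField_fixingSubgroup]
    · rintro ⟨h, ⟨h1, hch⟩, rfl⟩
      refine ⟨?_, by rw [hf, hz]; exact hch⟩
      have e1 : Module.finrank (f h) M = 2 := by
        rw [IntermediateField.finrank_fixedField_eq_card, Nat.card_zpowers]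
        exact orderOf_eq_prime (by rw [pow_two, hsq]) h1
      have := Module.finrank_mul_finrank ℚ (f h) M
      rw [IsGalois.card_aut_eq_finrank] at h4
      rw [e1, h4] at this
      omega
  rw [Nat.card_coe_set_eq, himg]
  apply Set.ncard_image_of_injOn
  rintro a ⟨ha, -⟩ b ⟨hb, -⟩ hab
  have h1 : a ∈ Subgroup.zpowers b := by
    rw [← hf, ← hab, hf]
    exact Subgroup.mem_zpowers _
  exact ((hz b a).1 h1).resolve_left ha

theorem aux_places (h4 : Nat.card (M ≃ₐ[ℚ] M) = 4) (φ : M →+* ℂ) (c : M ≃ₐ[ℚ] M)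
    (hc : ∀ x, φ (c x) = (starRingEnd ℂ) (φ x)) :
    Set.ncard {h : M ≃ₐ[ℚ] M | h ≠ 1 ∧ (c = 1 ∨ c = h)} =
      InfinitePlace.nrRealPlaces M + InfinitePlace.nrComplexPlaces M - 1 := by
  have hall : ∀ w : InfinitePlace M, w.IsReal ↔ (InfinitePlace.mk φ).IsReal := by
    intro w
    obtain ⟨s, hs⟩ := InfinitePlace.exists_smul_eq_of_comap_eq (k := ℚ) (w := InfinitePlace.mk φ)
      (w' := w) (Subsingleton.elim _ _)
    rw [← hs, InfinitePlace.isReal_smul_iff]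
  have hr : (InfinitePlace.mk φ).IsReal ↔ c = 1 := by
    rw [InfinitePlace.isReal_mk_iff, ComplexEmbedding.isReal_iff]
    constructor
    · intro h
      ext x
      apply φ.injective
      rw [hc]
      exact RingHom.congr_fun h x
    · rintro rfl
      ext x
      exact (hc x).symm
  have hrank := InfinitePlace.card_add_two_mul_card_eq_rank M
  rw [← IsGalois.card_aut_eq_finrank, h4] at hrank
  by_cases hc1 : c = 1
  · have ht : IsTotallyReal M := ⟨fun w => (hall w).2 (hr.2 hc1)⟩
    rw [nrComplexPlaces_eq_zero_iff.2 ht] at hrank ⊢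
    have : {h : M ≃ₐ[ℚ] M | h ≠ 1 ∧ (c = 1 ∨ c = h)} = {1}ᶜ := by
      ext h
      simp [hc1]
    rw [this, Set.ncard_compl, h4, Set.ncard_singleton]
    omega
  · have ht : IsTotallyComplex M := ⟨fun w => by
      rw [← InfinitePlace.not_isReal_iff_isComplex, hall, hr]
      exact hc1⟩
    rw [nrRealPlaces_eq_zero_iff.2 ht] at hrank ⊢
    have : {h : M ≃ₐ[ℚ] M | h ≠ 1 ∧ (c = 1 ∨ c = h)} = {c} := by
      ext h
      simp only [hc1, false_or, Set.mem_setOf_eq, Set.mem_singleton_iff]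
      constructor
      · exact fun h => h.2.symm
      · rintro rfl
        exact ⟨hc1, rfl⟩
    rw [this, Set.ncard_singleton]
    omega

end helpers



theorem statement_10 (M : Type*) [Field M] [NumberField M] [IsGalois ℚ M]
    (hgal : Nonempty ((M ≃ₐ[ℚ] M) ≃* (Multiplicative (ZMod 2) × Multiplicative (ZMod 2))))
    (J : Set (IntermediateField ℚ M))
    (hJ : J = {K : IntermediateField ℚ M | Module.finrank ℚ K = 2 ∧ Nonempty (K →+* ℝ)})
    (ε : J → (𝓞 M)ˣ)
    (hmem : ∀ K : J, ((ε K : 𝓞 M) : M) ∈ (K : IntermediateField ℚ M))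
    (hinf : ∀ (K : J) (n : ℕ), 1 ≤ n → (ε K) ^ n ≠ 1) :
    (∀ c : J → ℤ, (∃ n : ℕ, 1 ≤ n ∧ (∏ᶠ K : J, (ε K) ^ (c K)) ^ n = 1) → ∀ K : J, c K = 0) ∧
    Nonempty ((Subgroup.closure (Set.range ε) : Subgroup (𝓞 M)ˣ) ≃* Multiplicative (↥J →₀ ℤ)) ∧
    Nat.card J = InfinitePlace.nrRealPlaces M + InfinitePlace.nrComplexPlaces M - 1 := by
  obtain ⟨h4, hcomm, hsq⟩ := aux_group hgal
  have hfin0 : Finite (IntermediateField ℚ M) :=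
    Finite.of_equiv _ (IsGalois.intermediateFieldEquivSubgroup (F := ℚ) (E := M)).toEquiv.symm
  have hfin : Finite J := inferInstance
  have := Fintype.ofFinite J
  have hJ2 : ∀ K ∈ J, Module.finrank ℚ K = 2 := fun K hK => by
    rw [hJ] at hK
    exact hK.1
  have hind := aux_indep h4 hcomm hsq J hJ2 ε hmem hinf
  refine ⟨?_, ?_, ?_⟩
  · intro c hc
    simp only [finprod_eq_prod_of_fintype] at hc
    exact hind c hc
  · exact aux_free ε fun c hc => hind c ⟨1, le_rfl, by rw [hc, one_pow]⟩
  · obtain ⟨φ⟩ : Nonempty (M →+* ℂ) := inferInstance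
    obtain ⟨c, hc⟩ := aux_conj φ
    rw [← aux_places h4 φ c hc, ← aux_count h4 hsq c, hJ]
    simp only [aux_real hcomm φ c hc]
end

section
/- Let F be a field of characteristic ≠ 2 and let c ∈ F with c ≠ 0; set d := c². Then the map ℙ¹(F) × ℙ¹(F) → ℙ³(F) sending ([s : t], [u : v]) to [ (sv + tu)/2 : (sv − tu)/(2c) : tv : su ] is well defined (independent of homogeneous coordinates, with nonzero image) and is a bijection from ℙ¹(F) × ℙ¹(F) onto the set { [x : y : z : w] ∈ ℙ³(F) : x² − d·y² = z·w }. -/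
/-- The Segre-type vector. -/
def segV {F : Type*} [Field F] (c : F) (p q : Fin 2 → F) : Fin 4 → F :=
  ![(p 0 * q 1 + p 1 * q 0) / 2, (p 0 * q 1 - p 1 * q 0) / (2 * c), p 1 * q 1, p 0 * q 0]

theorem segV_prod {F : Type*} [Field F] (h2 : (2 : F) ≠ 0) (c : F) (hc : c ≠ 0)
    (a : F) (p q p' q' : Fin 2 → F) (h : a • segV c p' q' = segV c p q) :
    ∀ i j, p i * q j = a * (p' i * q' j) := by
  have e0 := congrFun h 0
  have e1 := congrFun h 1
  have e2 := congrFun h 2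
  have e3 := congrFun h 3
  simp [segV] at e0 e1 e2 e3
  field_simp at e0 e1
  have k1 : p 0 * q 1 = a * (p' 0 * q' 1) := by
    apply mul_left_cancel₀ h2
    linear_combination -e0 - e1
  have k2 : p 1 * q 0 = a * (p' 1 * q' 0) := by
    apply mul_left_cancel₀ h2
    linear_combination -e0 + e1
  intro i j
  fin_cases i <;> fin_cases j
  · exact e3.symm
  · exact k1
  · exact k2
  · exact e2.symm

theorem segV_ne {F : Type*} [Field F] (h2 : (2 : F) ≠ 0) (c : F) (hc : c ≠ 0)
    (p q : Fin 2 → F) (hp : p ≠ 0) (hq : q ≠ 0) : segV c p q ≠ 0 := by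
  intro h
  have := segV_prod h2 c hc 0 p q p q (by rw [h]; simp)
  obtain ⟨i, hi⟩ := Function.ne_iff.1 hp
  obtain ⟨j, hj⟩ := Function.ne_iff.1 hq
  have := this i j
  simp at this hi hj
  tauto

theorem segV_smul {F : Type*} [Field F] (c a b : F) (p q : Fin 2 → F) :
    segV c (a • p) (b • q) = (a * b) • segV c p q := by
  ext i
  fin_cases i <;> simp [segV] <;> ring

theorem prop_aux {F : Type*} [Field F] (a : F) (p q p' q' : Fin 2 → F) (hq : q ≠ 0)
    (h : ∀ i j, p i * q j = a * (p' i * q' j)) : ∃ b : F, b • p' = p := by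
  obtain ⟨j, hj⟩ := Function.ne_iff.1 hq
  simp at hj
  refine ⟨a * q' j / q j, ?_⟩
  ext i
  have := h i j
  simp
  field_simp
  linear_combination -this

/-- The map. -/
noncomputable def segF {F : Type*} [Field F] (h2 : (2 : F) ≠ 0) (c : F) (hc : c ≠ 0)
    (x : Projectivization F (Fin 2 → F) × Projectivization F (Fin 2 → F)) :
    Projectivization F (Fin 4 → F) :=
  Projectivization.mk F (segV c x.1.rep x.2.rep)
    (segV_ne h2 c hc _ _ x.1.rep_nonzero x.2.rep_nonzero)

theorem segF_mk {F : Type*} [Field F] (h2 : (2 : F) ≠ 0) (c : F) (hc : c ≠ 0)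
    (p q : Fin 2 → F) (hp : p ≠ 0) (hq : q ≠ 0) :
    segF h2 c hc (Projectivization.mk F p hp, Projectivization.mk F q hq) =
      Projectivization.mk F (segV c p q) (segV_ne h2 c hc p q hp hq) := by
  obtain ⟨a, ha⟩ := Projectivization.exists_smul_eq_mk_rep F p hp
  obtain ⟨b, hb⟩ := Projectivization.exists_smul_eq_mk_rep F q hq
  unfold segF
  rw [Projectivization.mk_eq_mk_iff']
  refine ⟨(a : F) * b, ?_⟩
  rw [← segV_smul]
  simp only [← ha, ← hb]
  rfl

theorem segV_surj {F : Type*} [Field F] (h2 : (2 : F) ≠ 0) (c : F) (hc : c ≠ 0)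
    (r : Fin 4 → F) (hr : r ≠ 0) (h : (r 0) ^ 2 - c ^ 2 * (r 1) ^ 2 = r 2 * r 3) :
    ∃ p q : Fin 2 → F, p ≠ 0 ∧ q ≠ 0 ∧ ∃ a : F, a • r = segV c p q := by
  have key : ∀ (p q : Fin 2 → F) (a : F), p 0 * q 1 = a * (r 0 + c * r 1) →
      p 1 * q 0 = a * (r 0 - c * r 1) → p 1 * q 1 = a * r 2 → p 0 * q 0 = a * r 3 →
      a • r = segV c p q := by
    intro p q a e1 e2 e3 e4
    ext i
    fin_cases i <;> simp [segV, e1, e2, e3, e4] <;> field_simp <;> ring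
  by_cases hA : r 0 + c * r 1 = 0
  · by_cases hz : r 2 = 0
    · refine ⟨![r 3, r 0 - c * r 1], ![1, 0], ?_, ?_, 1, key _ _ _ ?_ ?_ ?_ ?_⟩
      · intro h0
        have e0 := congrFun h0 0
        have e1 := congrFun h0 1
        simp at e0 e1
        have f0 : r 0 = 0 := by
          apply mul_left_cancel₀ h2
          linear_combination hA + e1
        have f1 : r 1 = 0 := by
          apply mul_left_cancel₀ hc
          linear_combination hA - f0
        apply hr
        ext i
        fin_cases i <;> simp [*]
      · intro h0
        simpa using congrFun h0 0
      all_goals simp [hA, hz]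
    · have hw : r 3 = 0 := by
        apply mul_left_cancel₀ hz
        linear_combination -h + hA * (r 0 - c * r 1)
      refine ⟨![0, r 2], ![r 0 - c * r 1, r 2], ?_, ?_, r 2, key _ _ _ ?_ ?_ ?_ ?_⟩
      · intro h0
        exact hz (by simpa using congrFun h0 1)
      · intro h0
        exact hz (by simpa using congrFun h0 1)
      all_goals simp [hA, hw]
  · refine ⟨![r 0 + c * r 1, r 2], ![r 3, r 0 + c * r 1], ?_, ?_, r 0 + c * r 1,
      key _ _ _ ?_ ?_ ?_ ?_⟩
    · intro h0
      exact hA (by simpa using congrFun h0 0)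
    · intro h0
      exact hA (by simpa using congrFun h0 1)
    · simp
    · simp
      linear_combination -h
    · simp
      ring
    · simp

theorem statement_14 (F : Type*) [Field F] (h2 : (2 : F) ≠ 0) (c : F) (hc : c ≠ 0) :
    ∃ f : Projectivization F (Fin 2 → F) × Projectivization F (Fin 2 → F) →
        Projectivization F (Fin 4 → F),
      (∀ (s t u v : F) (h1 : ![s, t] ≠ 0) (h2' : ![u, v] ≠ 0),
        ∃ hne : ![(s * v + t * u) / 2, (s * v - t * u) / (2 * c), t * v, s * u] ≠ 0,
          f (Projectivization.mk F ![s, t] h1, Projectivization.mk F ![u, v] h2') =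
            Projectivization.mk F
              ![(s * v + t * u) / 2, (s * v - t * u) / (2 * c), t * v, s * u] hne) ∧
      Set.BijOn f Set.univ
        {Q : Projectivization F (Fin 4 → F) |
          (Q.rep 0) ^ 2 - c ^ 2 * (Q.rep 1) ^ 2 = Q.rep 2 * Q.rep 3} := by
  refine ⟨segF h2 c hc, ?_, ?_, ?_, ?_⟩
  · intro s t u v h1 h2'
    exact ⟨segV_ne h2 c hc _ _ h1 h2', segF_mk h2 c hc _ _ h1 h2'⟩
  · rintro ⟨P, Q⟩ -
    obtain ⟨a, ha⟩ := Projectivization.exists_smul_eq_mk_rep F (segV c P.rep Q.rep)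
      (segV_ne h2 c hc _ _ P.rep_nonzero Q.rep_nonzero)
    simp only [Set.mem_setOf_eq, segF]
    rw [← ha]
    simp [segV, Units.smul_def]
    field_simp
    ring
  · rintro ⟨P, Q⟩ - ⟨P', Q'⟩ - h
    unfold segF at h
    rw [Projectivization.mk_eq_mk_iff'] at h
    obtain ⟨a, ha⟩ := h
    have hp := segV_prod h2 c hc a _ _ _ _ ha
    have e1 := prop_aux a _ _ _ _ Q.rep_nonzero hp
    have e2 := prop_aux a Q.rep P.rep Q'.rep P'.rep P.rep_nonzero (by
      intro i j
      linear_combination hp j i)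
    rw [← Projectivization.mk_eq_mk_iff' F _ _ P.rep_nonzero P'.rep_nonzero] at e1
    rw [← Projectivization.mk_eq_mk_iff' F _ _ Q.rep_nonzero Q'.rep_nonzero] at e2
    simp only [Projectivization.mk_rep] at e1 e2
    rw [e1, e2]
  · intro R hR
    obtain ⟨p, q, hp, hq, a, ha⟩ := segV_surj h2 c hc R.rep R.rep_nonzero hR
    refine ⟨(Projectivization.mk F p hp, Projectivization.mk F q hq), trivial, ?_⟩
    rw [segF_mk, ← Projectivization.mk_rep R, Projectivization.mk_eq_mk_iff']
    refine ⟨a, ?_⟩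
    simpa only [Projectivization.mk_rep] using ha
end
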